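/- arXiv:1903.03551 — 2 statements merged into one kernel-verified Lean document; each statement's English description precedes it below -/
import Mathlib

section
/- Let M be a perfect compact metric space, let X = M^ℤ be endowed with the metric r(x,y) = Σ_{n∈ℤ} min{1/(n²+1), d(x_n,y_n)}, and let T be the full shift on X. Then the set ED_+ = {μ ∈ M(T) : D⁺_μ(1) = +∞} is a residual subset of M(T). -/
open MeasureTheory Filter Topology Metric Set
open scoped ENNReal NNReal

section Defs

variable {X : Type*} [MetricSpace X] [MeasurableSpace X]

/-- The topological support of a Borel measure on a metric space: the set of points all of whose
balls have positive measure. -/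
def msupp (μ : Measure X) : Set X := {x : X | ∀ ε > 0, 0 < μ (ball x ε)}

/-- The energy function `I_μ(q, ε) = ∫_{supp μ} μ(B(x,ε))^(q-1) dμ(x)`. -/
noncomputable def energyI (μ : Measure X) (q ε : ℝ) : ℝ :=
  ∫ x in msupp μ, (μ (ball x ε)).toReal ^ (q - 1) ∂μ

/-- The lower `q`-generalized fractal dimension
`D⁻_μ(q) = liminf_{ε→0⁺} log I_μ(q,ε) / ((q-1) log ε)` (as an extended real number). -/
noncomputable def Dlower (μ : Measure X) (q : ℝ) : EReal :=
  liminf (fun ε : ℝ =>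
    ((Real.log (energyI μ q ε) / ((q - 1) * Real.log ε) : ℝ) : EReal)) (𝓝[>] (0 : ℝ))

/-- The upper `q`-generalized fractal dimension
`D⁺_μ(q) = limsup_{ε→0⁺} log I_μ(q,ε) / ((q-1) log ε)` (as an extended real number). -/
noncomputable def Dupper (μ : Measure X) (q : ℝ) : EReal :=
  limsup (fun ε : ℝ =>
    ((Real.log (energyI μ q ε) / ((q - 1) * Real.log ε) : ℝ) : EReal)) (𝓝[>] (0 : ℝ))

/-- `∫_{supp μ} log μ(B(x,ε)) dμ(x)`, the numerator in the entropy dimension. -/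
noncomputable def entNum (μ : Measure X) (ε : ℝ) : ℝ :=
  ∫ x in msupp μ, Real.log (μ (ball x ε)).toReal ∂μ

/-- The lower entropy dimension
`D⁻_μ(1) = liminf_{ε→0⁺} (∫_{supp μ} log μ(B(x,ε)) dμ(x)) / log ε`. -/
noncomputable def D1lower (μ : Measure X) : EReal :=
  liminf (fun ε : ℝ => ((entNum μ ε / Real.log ε : ℝ) : EReal)) (𝓝[>] (0 : ℝ))

/-- The upper entropy dimension
`D⁺_μ(1) = limsup_{ε→0⁺} (∫_{supp μ} log μ(B(x,ε)) dμ(x)) / log ε`. -/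
noncomputable def D1upper (μ : Measure X) : EReal :=
  limsup (fun ε : ℝ => ((entNum μ ε / Real.log ε : ℝ) : EReal)) (𝓝[>] (0 : ℝ))

/-- A measure is `T`-invariant if `μ(T⁻¹ s) = μ s` for every measurable `s`. -/
def IsInvariantMeasure (T : X → X) (μ : Measure X) : Prop :=
  ∀ s : Set X, MeasurableSet s → μ (T ⁻¹' s) = μ s

/-- `M(T)`: the set of `T`-invariant Borel probability measures on `X`. -/
def invSet (T : X → X) : Set (ProbabilityMeasure X) :=
  {μ : ProbabilityMeasure X | IsInvariantMeasure T μ.toMeasure}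

/-- A `T`-periodic measure: `μ = (1/k) ∑_{i<k} δ_{T^i x}` for a `T`-periodic point `x`
of period `k`. -/
def IsPeriodicMeasure (T : X → X) (μ : ProbabilityMeasure X) : Prop :=
  ∃ (x : X) (k : ℕ), 0 < k ∧ T^[k] x = x ∧
    μ.toMeasure = (k : ℝ≥0∞)⁻¹ • ∑ i ∈ Finset.range k, Measure.dirac (T^[i] x)

/-- The upper Hausdorff dimension of a measure:
`dim_H^+(μ) = inf {dimH E | E Borel, μ(X \ E) = 0}`. -/
noncomputable def dimHplus (μ : Measure X) : ℝ≥0∞ :=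
  ⨅ (E : Set X) (_ : MeasurableSet E) (_ : μ Eᶜ = 0), dimH E

/-- The lower Hausdorff dimension of a measure:
`dim_H^-(μ) = inf {dimH E | E Borel, μ(E) > 0}`. -/
noncomputable def dimHminus (μ : Measure X) : ℝ≥0∞ :=
  ⨅ (E : Set X) (_ : MeasurableSet E) (_ : 0 < μ E), dimH E

/-- The return time `τ_s(x) = inf {k ≥ 1 | T^k x ∈ B(x,s)}`. -/
noncomputable def tauRet (T : X → X) (s : ℝ) (x : X) : ℕ :=
  sInf {k : ℕ | 0 < k ∧ T^[k] x ∈ ball x s}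

/-- The lower recurrence rate `R̲(x) = liminf_{s→0⁺} log τ_s(x) / (-log s)`. -/
noncomputable def Rlower (T : X → X) (x : X) : EReal :=
  liminf (fun s : ℝ =>
    ((Real.log (tauRet T s x : ℝ) / (-Real.log s) : ℝ) : EReal)) (𝓝[>] (0 : ℝ))

open Classical in
/-- The lower local dimension `d̲_μ(x) = liminf_{ε→0⁺} log μ(B(x,ε)) / log ε` when all balls
around `x` have positive measure, and `+∞` otherwise. -/
noncomputable def dLoc (μ : Measure X) (x : X) : EReal :=
  if (∀ ε > 0, 0 < μ (ball x ε)) then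
    liminf (fun ε : ℝ =>
      ((Real.log (μ (ball x ε)).toReal / Real.log ε : ℝ) : EReal)) (𝓝[>] (0 : ℝ))
  else ⊤

/-- The auxiliary continuous kernel `f^ε_x(y)`: equal to `1` if `dist x y ≤ ε`, to
`2 - dist x y / ε` if `ε ≤ dist x y ≤ 2ε`, and to `0` if `dist x y ≥ 2ε`. -/
noncomputable def fker (ε : ℝ) (x y : X) : ℝ :=
  if dist x y ≤ ε then 1 else if dist x y ≤ 2 * ε then 2 - dist x y / ε else 0

/-- `f_ε(μ, x) = ∫ f^ε_x(y) dμ(y)`. -/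
noncomputable def feps (ε : ℝ) (μ : Measure X) (x : X) : ℝ := ∫ y, fker ε x y ∂μ

/-- `G` is a finite covering of `X` by open balls of radius `ε` (given by its finite set of
centers). -/
def IsBallCover (ε : ℝ) (G : Finset X) : Prop := (⋃ x ∈ G, ball x ε) = univ

/-- `S_μ(s,ε) = inf_G ∑_{x ∈ G} μ(B(x,ε))^s`, the infimum running over all finite coverings of
`X` by balls of radius `ε`. -/
noncomputable def Sfun (μ : Measure X) (s ε : ℝ) : ℝ :=
  ⨅ G : {H : Finset X // IsBallCover ε H}, ∑ x ∈ G.val, (μ (ball x ε)).toReal ^ s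

/-- `W_μ(s,ε) = inf_G ∑_{x ∈ G} f_ε(μ,x)^s`, the infimum running over all finite coverings of
`X` by balls of radius `ε`. -/
noncomputable def Wfun (μ : Measure X) (s ε : ℝ) : ℝ :=
  ⨅ G : {H : Finset X // IsBallCover ε H}, ∑ x ∈ G.val, (feps ε μ x) ^ s

/-- The regularized energy function `J_μ(q,ε) = ∫ f_ε(μ,x)^(q-1) dμ(x)`. -/
noncomputable def Jfun (μ : Measure X) (q ε : ℝ) : ℝ :=
  ∫ x, (feps ε μ x) ^ (q - 1) ∂μ

end Defs

section Shift

variable {M : Type*} [MetricSpace M]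

/-- The "cylinder ball" `B^n(x,ε) = {y | d(x_i, y_i) < ε for all |i| ≤ n}` in `M^ℤ`. -/
def cylBall (n : ℕ) (x : ℤ → M) (ε : ℝ) : Set (ℤ → M) :=
  {y : ℤ → M | ∀ i : ℤ, |i| ≤ (n : ℤ) → dist (x i) (y i) < ε}

/-- For `ε ∈ (0,1)`, the largest integer `n ≥ 0` with `ε < 1/(n²+1)`. -/
noncomputable def nZero (ε : ℝ) : ℕ := sSup {n : ℕ | ε < 1 / ((n : ℝ) ^ 2 + 1)}

/-- The modified energy function `I^n_μ(q,ε) = ∫ μ(B^n(x,ε))^(q-1) dμ(x)`. -/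
noncomputable def Icyl [MeasurableSpace (ℤ → M)] (μ : Measure (ℤ → M)) (n : ℕ) (q ε : ℝ) :
    ℝ :=
  ∫ x, (μ (cylBall n x ε)).toReal ^ (q - 1) ∂μ

end Shift

section EntropyNumerator

variable {X : Type*} [MetricSpace X] [CompactSpace X] [MeasurableSpace X]

lemma ae_mem_msupp (μ : Measure X) : ∀ᵐ x ∂μ, x ∈ msupp μ := by
  rw [ae_iff]
  refine measure_null_of_locally_null _ fun x hx => ?_
  simp only [msupp, Set.mem_ofPred_eq, not_forall, not_lt, nonpos_iff_eq_zero] at hx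
  obtain ⟨ε, hε, h⟩ := hx
  exact ⟨ball x ε, mem_nhdsWithin_of_mem_nhds (ball_mem_nhds x hε), h⟩

lemma entNum_eq_integral (μ : Measure X) (ε : ℝ) :
    entNum μ ε = ∫ x, Real.log (μ (ball x ε)).toReal ∂μ := by
  rw [entNum, Measure.restrict_eq_self_of_ae_mem (ae_mem_msupp μ)]

lemma exists_pos_le_measure_ball (μ : Measure X) [IsFiniteMeasure μ] {ε : ℝ} (hε : 0 < ε) :
    ∃ c > 0, ∀ x ∈ msupp μ, c ≤ (μ (ball x ε)).toReal := by
  classical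
  obtain ⟨t, -, ht, hcov⟩ := finite_cover_balls_of_compact (isCompact_univ (X := X)) (half_pos hε)
  obtain ⟨c, hc, hct⟩ : ∃ c > 0, ∀ y ∈ t, 0 < μ (ball y (ε / 2)) →
      c ≤ (μ (ball y (ε / 2))).toReal := by
    clear hcov
    induction t, ht using Set.Finite.induction_on with
    | empty => exact ⟨1, one_pos, by simp⟩
    | @insert a s _ _ ih =>
      obtain ⟨c, hc, h⟩ := ih
      by_cases ha : 0 < μ (ball a (ε / 2))
      · refine ⟨min c (μ (ball a (ε / 2))).toReal,
          lt_min hc (ENNReal.toReal_pos ha.ne' (measure_ne_top _ _)), ?_⟩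
        rintro y (rfl | hy) hpos
        · exact min_le_right _ _
        · exact (min_le_left _ _).trans (h y hy hpos)
      · refine ⟨c, hc, ?_⟩
        rintro y (rfl | hy) hpos
        · exact absurd hpos ha
        · exact h y hy hpos
  refine ⟨c, hc, fun x hx => ?_⟩
  obtain ⟨y, hy, hxy⟩ := Set.mem_iUnion₂.1 (hcov (mem_univ x))
  have hpos : 0 < μ (ball y (ε / 2)) := by
    obtain ⟨r, hr, hsub⟩ := Metric.isOpen_iff.1 isOpen_ball x hxy
    exact (hx r hr).trans_le (measure_mono hsub)
  refine (hct y hy hpos).trans (ENNReal.toReal_mono (measure_ne_top _ _) (measure_mono ?_))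
  refine ball_subset_ball' ?_
  have : dist y x < ε / 2 := by simpa [dist_comm] using hxy
  linarith

variable [BorelSpace X]

lemma measurable_log_measure_ball (μ : Measure X) [IsFiniteMeasure μ] (ε : ℝ) :
    Measurable fun x => Real.log (μ (ball x ε)).toReal := by
  have hs : MeasurableSet {p : X × X | dist p.2 p.1 < ε} :=
    measurableSet_lt (measurable_snd.dist measurable_fst) measurable_const
  exact (measurable_measure_prodMk_left (ν := μ) hs).ennreal_toReal.log

lemma integrable_log_measure_ball (μ : Measure X) [IsProbabilityMeasure μ] {ε : ℝ} (hε : 0 < ε) :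
    Integrable (fun x => Real.log (μ (ball x ε)).toReal) μ := by
  obtain ⟨c, hc, h⟩ := exists_pos_le_measure_ball μ hε
  refine Integrable.of_bound (measurable_log_measure_ball μ ε).aestronglyMeasurable
    (-Real.log c) ?_
  filter_upwards [ae_mem_msupp μ] with x hx
  have h0 := h x hx
  have h1 : (μ (ball x ε)).toReal ≤ 1 := measureReal_le_one
  rw [Real.norm_eq_abs, abs_of_nonpos (Real.log_nonpos (hc.le.trans h0) h1)]
  exact neg_le_neg (Real.log_le_log hc h0)

lemma entNum_le_of_measure_ball_le (μ : Measure X) [IsProbabilityMeasure μ] {ε b : ℝ}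
    (hε : 0 < ε) {S : Set X} (hS : MeasurableSet S)
    (h : ∀ x ∈ S, (μ (ball x ε)).toReal ≤ b) :
    entNum μ ε ≤ μ.real S * Real.log b := by
  rw [entNum_eq_integral, ← smul_eq_mul, ← integral_indicator_const _ hS]
  refine integral_mono_ae (integrable_log_measure_ball μ hε)
    ((integrable_const _).indicator hS) ?_
  filter_upwards [ae_mem_msupp μ] with x hx
  have hpos : 0 < (μ (ball x ε)).toReal := ENNReal.toReal_pos (hx ε hε).ne' (measure_ne_top _ _)
  by_cases hxS : x ∈ S
  · simpa [hxS] using Real.log_le_log hpos (h x hxS)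
  · simpa [hxS] using Real.log_nonpos hpos.le measureReal_le_one

/-- If `2 ^ (2 n + 1)` pairwise disjoint sets `V p` contain the `ε`-neighbourhoods of sets `U p`
of measure at least `c`, then all but `2 ^ n` of the `V p` have measure at most `2 ^ (-n)`, which
bounds the entropy numerator. -/
lemma entNum_le_of_disjoint (μ : Measure X) [IsProbabilityMeasure μ] {ε c : ℝ} (hε : 0 < ε)
    (hc : 0 ≤ c) {ι : Type*} [Fintype ι] {n : ℕ} (hι : Fintype.card ι = 2 ^ (2 * n + 1))
    {U V : ι → Set X} (hU : ∀ p, MeasurableSet (U p)) (hV : ∀ p, MeasurableSet (V p))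
    (hUV : ∀ p, U p ⊆ V p) (hdisj : Pairwise (Function.onFun Disjoint V))
    (hball : ∀ p, ∀ x ∈ U p, ball x ε ⊆ V p) (hμ : ∀ p, c ≤ μ.real (U p)) :
    entNum μ ε ≤ -(2 ^ (2 * n) * c * (n * Real.log 2)) := by
  classical
  set good : Finset ι := {p | μ.real (V p) ≤ (2 ^ n)⁻¹} with hgood
  set bad : Finset ι := {p | ¬ μ.real (V p) ≤ (2 ^ n)⁻¹} with hbad
  have hcard : good.card + bad.card = 2 ^ (2 * n + 1) := by
    rw [← hι, ← Finset.card_univ, Finset.card_filter_add_card_filter_not]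
  have hbadcard : (bad.card : ℝ) ≤ 2 ^ n := by
    have h1 : ∑ p ∈ bad, μ.real (V p) ≤ 1 := by
      rw [← measureReal_biUnion_finset (fun p _ q _ hpq => hdisj hpq) (fun p _ => hV p)]
      exact measureReal_le_one
    have h2 : bad.card • ((2 : ℝ) ^ n)⁻¹ ≤ ∑ p ∈ bad, μ.real (V p) := by
      refine Finset.card_nsmul_le_sum _ _ _ fun p hp => ?_
      exact (not_le.1 (Finset.mem_filter.1 hp).2).le
    rw [nsmul_eq_mul, ← div_eq_mul_inv] at h2
    exact (div_le_one (by positivity)).1 (h2.trans h1)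
  have hgoodcard : (2 : ℝ) ^ (2 * n) ≤ good.card := by
    have h1 : (good.card : ℝ) + bad.card = 2 ^ (2 * n + 1) := by exact_mod_cast hcard
    have h2 : (2 : ℝ) ^ n ≤ 2 ^ (2 * n) := pow_le_pow_right₀ one_le_two (by omega)
    rw [pow_succ] at h1
    linarith
  have hS : 2 ^ (2 * n) * c ≤ μ.real (⋃ p ∈ good, U p) := by
    rw [measureReal_biUnion_finset (fun p _ q _ hpq => (hdisj hpq).mono (hUV p) (hUV q))
      (fun p _ => hU p)]
    calc 2 ^ (2 * n) * c ≤ good.card * c := by gcongr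
      _ = good.card • c := (nsmul_eq_mul _ _).symm
      _ ≤ _ := Finset.card_nsmul_le_sum _ _ _ fun p _ => hμ p
  have key := entNum_le_of_measure_ball_le μ (b := (2 ^ n)⁻¹) hε
    (S := ⋃ p ∈ good, U p) (good.measurableSet_biUnion fun p _ => hU p) (by
      intro x hx
      obtain ⟨p, hp, hxp⟩ := Set.mem_iUnion₂.1 hx
      exact (ENNReal.toReal_mono (measure_ne_top _ _) (measure_mono (hball p x hxp))).trans
        (Finset.mem_filter.1 hp).2)
  refine key.trans ?_
  rw [Real.log_inv, Real.log_pow, mul_neg]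
  gcongr

end EntropyNumerator

section ProbabilityMeasures

variable {X : Type*} [MeasurableSpace X]

lemma isOpen_setOf_lt_measureReal [TopologicalSpace X] [OpensMeasurableSpace X]
    [HasOuterApproxClosed X] {U : Set X} (hU : IsOpen U) {c : ℝ} (hc : 0 ≤ c) :
    IsOpen {μ : ProbabilityMeasure X | c < μ.toMeasure.real U} := by
  have h : {μ : ProbabilityMeasure X | c < μ.toMeasure.real U} =
      {μ : ProbabilityMeasure X | ENNReal.ofReal c < μ.toMeasure U} := by
    ext μ
    exact (ENNReal.ofReal_lt_iff_lt_toReal hc (measure_ne_top _ _)).symm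
  rw [h, isOpen_iff_mem_nhds]
  intro μ hμ
  exact eventually_lt_of_lt_liminf
    (lt_of_lt_of_le hμ (ProbabilityMeasure.le_liminf_measure_open_of_tendsto tendsto_id hU))

/-- The convex combination `(1 - t) μ + t ν` of two probability measures. -/
noncomputable def mixMeasure (t : ℝ≥0) (ht : t ≤ 1) (μ ν : ProbabilityMeasure X) :
    ProbabilityMeasure X :=
  ⟨(1 - t) • μ.toMeasure + t • ν.toMeasure, ⟨by
    simp only [Measure.add_apply, Measure.smul_apply, measure_univ, ENNReal.smul_def, smul_eq_mul,
      mul_one]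
    exact_mod_cast tsub_add_cancel_of_le ht⟩⟩

lemma mixMeasure_apply (t : ℝ≥0) (ht : t ≤ 1) (μ ν : ProbabilityMeasure X) (s : Set X) :
    (mixMeasure t ht μ ν).toMeasure s = (1 - t) • μ.toMeasure s + t • ν.toMeasure s := rfl

lemma mixMeasure_mem_invSet [MetricSpace X] {T : X → X} {t : ℝ≥0} (ht : t ≤ 1)
    {μ ν : ProbabilityMeasure X} (hμ : μ ∈ invSet T) (hν : ν ∈ invSet T) :
    mixMeasure t ht μ ν ∈ invSet T := by
  intro s hs
  rw [mixMeasure_apply, mixMeasure_apply, hμ s hs, hν s hs]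

lemma le_mixMeasure_real (t : ℝ≥0) (ht : t ≤ 1) (μ ν : ProbabilityMeasure X) (s : Set X) :
    t * ν.toMeasure.real s ≤ (mixMeasure t ht μ ν).toMeasure.real s := by
  have h : (t : ℝ≥0∞) * ν.toMeasure s ≤ (mixMeasure t ht μ ν).toMeasure s := by
    rw [mixMeasure_apply]
    exact le_add_self
  simpa [measureReal_def] using ENNReal.toReal_mono (measure_ne_top _ _) h

lemma tendsto_mixMeasure [TopologicalSpace X] [OpensMeasurableSpace X]
    (μ : ProbabilityMeasure X) (ν : ℕ → ProbabilityMeasure X) {t : ℕ → ℝ≥0}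
    (ht : ∀ j, t j ≤ 1) (ht0 : Tendsto t atTop (𝓝 0)) :
    Tendsto (fun j => mixMeasure (t j) (ht j) μ (ν j)) atTop (𝓝 μ) := by
  rw [ProbabilityMeasure.tendsto_iff_forall_integral_tendsto]
  intro f
  have h1 : ∀ j, ∫ x, f x ∂(mixMeasure (t j) (ht j) μ (ν j)).toMeasure =
      (1 - (t j : ℝ)) * ∫ x, f x ∂μ.toMeasure + t j * ∫ x, f x ∂(ν j).toMeasure := by
    intro j
    change ∫ x, f x ∂((1 - t j) • μ.toMeasure + t j • (ν j).toMeasure) = _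
    rw [integral_add_measure (.smul_measure_nnreal (f.integrable _))
      (.smul_measure_nnreal (f.integrable _)), integral_smul_nnreal_measure,
      integral_smul_nnreal_measure, NNReal.smul_def, NNReal.smul_def, NNReal.coe_sub (ht j)]
    simp
  have ht0' : Tendsto (fun j => (t j : ℝ)) atTop (𝓝 0) :=
    NNReal.tendsto_coe.2 ht0
  have h2 : Tendsto (fun j => (t j : ℝ) * ∫ x, f x ∂(ν j).toMeasure) atTop (𝓝 0) := by
    refine squeeze_zero_norm (a := fun j => (t j : ℝ) * ‖f‖) (fun j => ?_)
      (by simpa using ht0'.mul_const ‖f‖)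
    rw [norm_mul, Real.norm_of_nonneg (t j).coe_nonneg]
    gcongr
    exact f.norm_integral_le_norm _
  simp_rw [h1]
  simpa using ((ht0'.const_sub 1).mul_const (∫ x, f x ∂μ.toMeasure)).add h2

end ProbabilityMeasures

section PeriodicWords

variable {M : Type*}

/-- The periodic sequence in `{a, b}^ℤ` prescribed by a word indexed by the residues
modulo `2 n + 1`. -/
def periodicWord (a b : M) (n : ℕ) (p : ZMod (2 * n + 1) → Bool) : ℤ → M :=
  fun i => if p i then a else b

lemma periodicWord_shift (a b : M) (n : ℕ) (p : ZMod (2 * n + 1) → Bool) (i : ℤ) :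
    periodicWord a b n (fun z => p (z - 1)) i = periodicWord a b n p (i - 1) := by
  simp [periodicWord]

lemma exists_dist_periodicWord_eq [MetricSpace M] (a b : M) (n : ℕ)
    {p q : ZMod (2 * n + 1) → Bool} (hpq : p ≠ q) :
    ∃ i : ℤ, |i| ≤ n ∧ dist (periodicWord a b n p i) (periodicWord a b n q i) = dist a b := by
  obtain ⟨z, hz⟩ := Function.ne_iff.1 hpq
  refine ⟨z.valMinAbs, ?_, ?_⟩
  · have := ZMod.natAbs_valMinAbs_le z
    rw [Int.abs_eq_natAbs]
    omega
  · rw [periodicWord, periodicWord, ZMod.coe_valMinAbs]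
    cases hp : p z <;> cases hq : q z <;> simp_all [dist_comm]

lemma disjoint_cylBall_periodicWord [MetricSpace M] {a b : M} {η : ℝ} (hη : 2 * η ≤ dist a b)
    (n : ℕ) {p q : ZMod (2 * n + 1) → Bool} (hpq : p ≠ q) :
    Disjoint (cylBall n (periodicWord a b n p) η) (cylBall n (periodicWord a b n q) η) := by
  rw [Set.disjoint_left]
  intro y hp hq
  obtain ⟨i, hi, hd⟩ := exists_dist_periodicWord_eq a b n hpq
  have h1 := hp i hi
  have h2 := hq i hi
  have h3 := dist_triangle_right (periodicWord a b n p i) (periodicWord a b n q i) (y i)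
  linarith

variable {X : Type*} [MeasurableSpace X]

/-- The uniform distribution on the points of `X ≃ M^ℤ` that are `(2 n + 1)`-periodic sequences
in `{a, b}`. -/
noncomputable def periodicWordMeasure (e : X ≃ (ℤ → M)) (a b : M) (n : ℕ) :
    ProbabilityMeasure X :=
  ⟨((2 : ℝ≥0∞) ^ (2 * n + 1))⁻¹ •
      ∑ p : ZMod (2 * n + 1) → Bool, Measure.dirac (e.symm (periodicWord a b n p)), ⟨by
    simp only [Measure.smul_apply, Measure.finsetSum_apply, measure_univ, Finset.sum_const,
      Finset.card_univ, Fintype.card_fun, Fintype.card_bool, ZMod.card, nsmul_eq_mul, mul_one,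
      smul_eq_mul, Nat.cast_pow, Nat.cast_ofNat]
    exact ENNReal.inv_mul_cancel (by simp) (by simp)⟩⟩

lemma periodicWordMeasure_apply (e : X ≃ (ℤ → M)) (a b : M) (n : ℕ) (s : Set X) :
    (periodicWordMeasure e a b n).toMeasure s = ((2 : ℝ≥0∞) ^ (2 * n + 1))⁻¹ *
      ∑ p : ZMod (2 * n + 1) → Bool, Measure.dirac (e.symm (periodicWord a b n p)) s := by
  change (((2 : ℝ≥0∞) ^ (2 * n + 1))⁻¹ • ∑ p : ZMod (2 * n + 1) → Bool,
    Measure.dirac (e.symm (periodicWord a b n p)) : Measure X) s = _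
  simp [Measure.finsetSum_apply]

lemma le_periodicWordMeasure_real (e : X ≃ (ℤ → M)) (a b : M) (n : ℕ)
    (p : ZMod (2 * n + 1) → Bool) {s : Set X} (hs : e.symm (periodicWord a b n p) ∈ s) :
    ((2 : ℝ) ^ (2 * n + 1))⁻¹ ≤ (periodicWordMeasure e a b n).toMeasure.real s := by
  have h : ((2 : ℝ≥0∞) ^ (2 * n + 1))⁻¹ ≤ (periodicWordMeasure e a b n).toMeasure s := by
    rw [periodicWordMeasure_apply]
    refine le_mul_of_one_le_right zero_le ?_
    calc (1 : ℝ≥0∞) = Measure.dirac (e.symm (periodicWord a b n p)) s :=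
          (Measure.dirac_apply_of_mem hs).symm
      _ ≤ _ := Finset.single_le_sum
          (f := fun q => Measure.dirac (e.symm (periodicWord a b n q)) s)
          (fun _ _ => zero_le) (Finset.mem_univ p)
  simpa [measureReal_def] using ENNReal.toReal_mono (measure_ne_top _ _) h

lemma periodicWordMeasure_mem_invSet [MetricSpace X] [BorelSpace X] (e : X ≃ (ℤ → M))
    {T : X → X} (hT : ∀ x i, e (T x) i = e x (i - 1)) (a b : M) (n : ℕ) :
    periodicWordMeasure e a b n ∈ invSet T := by
  intro s hs
  rw [periodicWordMeasure_apply, periodicWordMeasure_apply,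
    ← Equiv.sum_comp ((Equiv.subRight (1 : ZMod (2 * n + 1))).symm.arrowCongr (Equiv.refl Bool))
      (fun p => Measure.dirac (e.symm (periodicWord a b n p)) s)]
  congr 1
  refine Finset.sum_congr rfl fun p _ => ?_
  have h : e.symm (periodicWord a b n
      ((Equiv.subRight (1 : ZMod (2 * n + 1))).symm.arrowCongr (Equiv.refl Bool) p)) =
      T (e.symm (periodicWord a b n p)) := by
    rw [Equiv.symm_apply_eq]
    ext i
    rw [hT, Equiv.apply_symm_apply, ← periodicWord_shift]
    rfl
  rw [h, Measure.dirac_apply, Measure.dirac_apply]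
  rfl

end PeriodicWords

section Residual

lemma isOpen_preimage_cylBall {X M : Type*} [TopologicalSpace X] [MetricSpace M]
    {e : X → ℤ → M} (he : ∀ i, Continuous fun x => e x i) (n : ℕ) (w : ℤ → M) (η : ℝ) :
    IsOpen (e ⁻¹' cylBall n w η) := by
  have h : e ⁻¹' cylBall n w η =
      ⋂ i ∈ Finset.Icc (-(n : ℤ)) n, {x | dist (w i) (e x i) < η} := by
    ext x
    simp [cylBall, abs_le]
  rw [h]
  exact isOpen_biInter_finset fun i _ => isOpen_lt (continuous_const.dist (he i)) continuous_const

lemma ball_subset_preimage_cylBall {X M : Type*} [MetricSpace X] [MetricSpace M]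
    {e : X → ℤ → M}
    (hdist : ∀ x y (i : ℤ), min (1 / ((i : ℝ) ^ 2 + 1)) (dist (e x i) (e y i)) ≤ dist x y)
    {n : ℕ} {w : ℤ → M} {η : ℝ} (hn : 1 / ((n : ℝ) ^ 2 + 1) ≤ η) {x : X}
    (hx : x ∈ e ⁻¹' cylBall n w η) :
    ball x (1 / ((n : ℝ) ^ 2 + 1)) ⊆ e ⁻¹' cylBall n w (2 * η) := by
  intro y hy i hi
  have h1 : dist x y < 1 / ((n : ℝ) ^ 2 + 1) := by simpa [dist_comm] using hy
  have hi' : |(i : ℝ)| ≤ n := by exact_mod_cast hi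
  have h2 : 1 / ((n : ℝ) ^ 2 + 1) ≤ 1 / ((i : ℝ) ^ 2 + 1) := by
    have : (i : ℝ) ^ 2 ≤ (n : ℝ) ^ 2 := sq_le_sq.2 (by simpa using hi')
    gcongr
  have h3 : dist (e x i) (e y i) < η := by
    rcases min_lt_iff.1 ((hdist x y i).trans_lt h1) with h | h
    · exact absurd h (not_lt.2 h2)
    · exact h.trans_le hn
  have h4 := hx i hi
  have h5 := dist_triangle (w i) (e x i) (e y i)
  linarith

lemma eventually_mul_log_le (k : ℕ) {c : ℝ} (hc : 0 < c) :
    ∀ᶠ n : ℕ in atTop, k * Real.log ((n : ℝ) ^ 2 + 1) ≤ n * c := by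
  have h : ∀ᶠ x : ℝ in atTop, ‖Real.log x‖ ≤ c / (4 * k + 4) * ‖x‖ :=
    Real.isLittleO_log_id_atTop.bound (by positivity)
  have hlim : Tendsto (fun n : ℕ => (n : ℝ) + 1) atTop atTop :=
    tendsto_atTop_add_const_right _ _ tendsto_natCast_atTop_atTop
  filter_upwards [hlim.eventually h, eventually_ge_atTop 1] with n hn hn1
  have hn1' : (1 : ℝ) ≤ n := by exact_mod_cast hn1
  rw [Real.norm_of_nonneg (Real.log_nonneg (by linarith)), Real.norm_of_nonneg (by linarith)] at hn
  have h1 : Real.log ((n : ℝ) ^ 2 + 1) ≤ 2 * Real.log ((n : ℝ) + 1) := by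
    have h2 : 2 * Real.log ((n : ℝ) + 1) = Real.log (((n : ℝ) + 1) ^ 2) := by simp
    rw [h2]
    exact Real.log_le_log (by positivity) (by nlinarith)
  have h2 : Real.log ((n : ℝ) ^ 2 + 1) ≤ 4 * (c / (4 * k + 4) * n) := by
    have : c / (4 * k + 4) * ((n : ℝ) + 1) ≤ c / (4 * k + 4) * (2 * n) := by gcongr; linarith
    linarith
  calc k * Real.log ((n : ℝ) ^ 2 + 1) ≤ (k + 1) * (4 * (c / (4 * k + 4) * n)) := by
        gcongr
        · exact Real.log_nonneg (by nlinarith)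
        · linarith
    _ = n * c := by field_simp

variable {X M : Type*} [MetricSpace X] [MeasurableSpace X] [BorelSpace X] [MetricSpace M]

/-- The invariant measures whose entropy numerator at some scale `1 / (n ^ 2 + 1)` with `k ≤ n` is
forced to be large because every word in `{a, b}` of length `2 n + 1` is charged. -/
def chargedSet (e : X ≃ (ℤ → M)) (T : X → X) (a b : M) (k : ℕ) : Set ↥(invSet T) :=
  {μ | ∃ n : ℕ, k ≤ n ∧ 1 ≤ n ∧ 1 / ((n : ℝ) ^ 2 + 1) ≤ dist a b / 4 ∧ ∃ δ : ℝ, 0 < δ ∧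
    k * Real.log ((n : ℝ) ^ 2 + 1) ≤ n * (Real.log 2 * δ / 4) ∧
    ∀ p : ZMod (2 * n + 1) → Bool, δ / 2 ^ (2 * n + 2) <
      μ.val.toMeasure.real (e ⁻¹' cylBall n (periodicWord a b n p) (dist a b / 4))}

lemma isOpen_chargedSet {e : X ≃ (ℤ → M)} (he : ∀ i, Continuous fun x => e x i) (T : X → X)
    (a b : M) (k : ℕ) : IsOpen (chargedSet e T a b k) := by
  have h : chargedSet e T a b k = ⋃ n : ℕ, ⋃ (_ : k ≤ n ∧ 1 ≤ n ∧
      1 / ((n : ℝ) ^ 2 + 1) ≤ dist a b / 4), ⋃ δ : ℝ, ⋃ (_ : 0 < δ ∧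
      k * Real.log ((n : ℝ) ^ 2 + 1) ≤ n * (Real.log 2 * δ / 4)),
      ⋂ p : ZMod (2 * n + 1) → Bool, Subtype.val ⁻¹' {μ : ProbabilityMeasure X |
        δ / 2 ^ (2 * n + 2) <
          μ.toMeasure.real (e ⁻¹' cylBall n (periodicWord a b n p) (dist a b / 4))} := by
    ext μ
    simp only [chargedSet, Set.mem_ofPred_eq, Set.mem_iUnion, Set.mem_iInter, Set.mem_preimage,
      exists_prop, and_assoc]
  rw [h]
  refine isOpen_iUnion fun n => isOpen_iUnion fun _ => isOpen_iUnion fun δ =>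
    isOpen_iUnion fun hδ => isOpen_iInter_of_finite fun p => ?_
  exact (isOpen_setOf_lt_measureReal (isOpen_preimage_cylBall he n _ _)
    (div_nonneg hδ.1.le (by positivity))).preimage continuous_subtype_val

lemma dense_chargedSet (e : X ≃ (ℤ → M)) {T : X → X}
    (hT : ∀ x i, e (T x) i = e x (i - 1)) {a b : M} (hab : a ≠ b) (k : ℕ) :
    Dense (chargedSet e T a b k) := by
  intro μ
  have hd : 0 < dist a b / 4 := by have := dist_pos.2 hab; positivity
  have hlog2 : 0 < Real.log 2 := Real.log_pos one_lt_two
  set t : ℕ → ℝ≥0 := fun j => 1 / ((j : ℝ≥0) + 1) with ht_def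
  have htpos : ∀ j, 0 < t j := fun j => by positivity
  have ht : ∀ j, t j ≤ 1 := fun j => div_le_one_of_le₀ (by simp) (by simp)
  have ht0 : Tendsto t atTop (𝓝 0) := tendsto_one_div_add_atTop_nhds_zero_nat
  have hscale : ∀ᶠ n : ℕ in atTop, 1 / ((n : ℝ) ^ 2 + 1) ≤ dist a b / 4 := by
    have h1 : ∀ᶠ n : ℕ in atTop, 1 / ((n : ℝ) + 1) < dist a b / 4 :=
      tendsto_one_div_add_atTop_nhds_zero_nat.eventually_lt_const hd
    filter_upwards [h1, eventually_ge_atTop 1] with n hn hn1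
    have hn1' : (1 : ℝ) ≤ n := by exact_mod_cast hn1
    refine le_trans ?_ hn.le
    gcongr
    nlinarith
  have hex : ∀ j, ∃ n : ℕ, k ≤ n ∧ 1 ≤ n ∧ 1 / ((n : ℝ) ^ 2 + 1) ≤ dist a b / 4 ∧
      k * Real.log ((n : ℝ) ^ 2 + 1) ≤ n * (Real.log 2 * t j / 4) := by
    intro j
    have hc : 0 < Real.log 2 * t j / 4 := by have : (0 : ℝ) < t j := htpos j; positivity
    exact ((eventually_ge_atTop k).and ((eventually_ge_atTop 1).and
      (hscale.and (eventually_mul_log_le k hc)))).exists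
  choose n hkn h1n hεn hlog using hex
  let ν : ℕ → ↥(invSet T) := fun j =>
    ⟨mixMeasure (t j) (ht j) μ.val (periodicWordMeasure e a b (n j)),
      mixMeasure_mem_invSet (ht j) μ.property (periodicWordMeasure_mem_invSet e hT a b (n j))⟩
  have hν : Tendsto ν atTop (𝓝 μ) := tendsto_subtype_rng.2 (tendsto_mixMeasure _ _ ht ht0)
  refine mem_closure_of_tendsto hν (Eventually.of_forall fun j => ?_)
  have htj : (0 : ℝ) < t j := htpos j
  refine ⟨n j, hkn j, h1n j, hεn j, t j, htj, hlog j, fun p => ?_⟩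
  refine lt_of_lt_of_le ?_ (le_mixMeasure_real (t j) (ht j) _ _ _)
  refine lt_of_lt_of_le ?_ (mul_le_mul_of_nonneg_left
    (le_periodicWordMeasure_real e a b (n j) p ?_) htj.le)
  · rw [← div_eq_mul_inv]
    gcongr <;> norm_num
  · simpa [cylBall] using fun i _ => hd

variable [CompactSpace X]

lemma exists_entNum_div_log_ge {e : X ≃ (ℤ → M)} (he : ∀ i, Continuous fun x => e x i)
    (hdist : ∀ x y (i : ℤ), min (1 / ((i : ℝ) ^ 2 + 1)) (dist (e x i) (e y i)) ≤ dist x y)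
    {T : X → X} {a b : M} {k : ℕ} {μ : ↥(invSet T)}
    (hμ : μ ∈ chargedSet e T a b k) :
    ∃ n : ℕ, k ≤ n ∧ (k : ℝ) ≤ entNum μ.val.toMeasure (1 / ((n : ℝ) ^ 2 + 1)) /
      Real.log (1 / ((n : ℝ) ^ 2 + 1)) := by
  obtain ⟨n, hkn, h1n, hεn, δ, hδ, hlog, hp⟩ := hμ
  refine ⟨n, hkn, ?_⟩
  have hn1 : (1 : ℝ) ≤ n := by exact_mod_cast h1n
  have hlogpos : 0 < Real.log ((n : ℝ) ^ 2 + 1) := Real.log_pos (by nlinarith)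
  have key := entNum_le_of_disjoint μ.val.toMeasure (ε := 1 / ((n : ℝ) ^ 2 + 1))
    (c := δ / 2 ^ (2 * n + 2)) (by positivity) (by positivity)
    (ι := ZMod (2 * n + 1) → Bool) (n := n) (by simp [ZMod.card])
    (U := fun p => e ⁻¹' cylBall n (periodicWord a b n p) (dist a b / 4))
    (V := fun p => e ⁻¹' cylBall n (periodicWord a b n p) (2 * (dist a b / 4)))
    (fun p => (isOpen_preimage_cylBall he _ _ _).measurableSet)
    (fun p => (isOpen_preimage_cylBall he _ _ _).measurableSet)
    (fun p x hx i hi => (hx i hi).trans_le (by linarith [dist_nonneg (x := a) (y := b)]))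
    (fun p q hpq => (disjoint_cylBall_periodicWord (by linarith) n hpq).preimage e)
    (fun p x hx => ball_subset_preimage_cylBall hdist hεn hx) (fun p => (hp p).le)
  have hmass : (2 : ℝ) ^ (2 * n) * (δ / 2 ^ (2 * n + 2)) * (n * Real.log 2) =
      n * (Real.log 2 * δ / 4) := by
    rw [pow_add]
    field_simp
    norm_num
  rw [hmass] at key
  rw [one_div, Real.log_inv, div_neg, ← neg_div, le_div_iff₀ hlogpos, ← one_div]
  linarith

lemma D1upper_eq_top {e : X ≃ (ℤ → M)} (he : ∀ i, Continuous fun x => e x i)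
    (hdist : ∀ x y (i : ℤ), min (1 / ((i : ℝ) ^ 2 + 1)) (dist (e x i) (e y i)) ≤ dist x y)
    {T : X → X} {a b : M} {μ : ↥(invSet T)} (hμ : ∀ k, μ ∈ chargedSet e T a b k) :
    D1upper μ.val.toMeasure = ⊤ := by
  choose n hkn hn using fun k => exists_entNum_div_log_ge he hdist (hμ k)
  have hlim : Tendsto (fun k => 1 / ((n k : ℝ) ^ 2 + 1)) atTop (𝓝[>] 0) := by
    have h1 : Tendsto (fun k => (n k : ℝ)) atTop atTop :=
      tendsto_natCast_atTop_atTop.comp (tendsto_atTop_mono hkn tendsto_id)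
    have h2 : Tendsto (fun k => (n k : ℝ) ^ 2 + 1) atTop atTop :=
      tendsto_atTop_add_const_right _ _ ((tendsto_pow_atTop two_ne_zero).comp h1)
    simpa only [one_div, Function.comp_def] using tendsto_inv_atTop_nhdsGT_zero.comp h2
  refine top_le_iff.1 (le_of_forall_lt fun y hy => ?_)
  obtain ⟨z, hyz, -⟩ := EReal.lt_iff_exists_real_btwn.1 hy
  refine hyz.trans_le (le_limsup_of_frequently_le (hlim.frequently ?_))
  refine Eventually.frequently ?_
  filter_upwards [tendsto_natCast_atTop_atTop.eventually_ge_atTop z] with k hk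
  exact EReal.coe_le_coe_iff.2 (hk.trans (hn k))

/-- For a shift `T` with coordinates `e : X ≃ M ^ ℤ`, the invariant measures of
infinite upper entropy dimension are residual. -/
lemma residual_D1upper_eq_top [tX : TopologicalSpace X]
    (htop : tX = ‹MetricSpace X›.toPseudoMetricSpace.toUniformSpace.toTopologicalSpace)
    [OpensMeasurableSpace X] {e : X ≃ (ℤ → M)}
    (he : ∀ i, Continuous fun x => e x i)
    (hdist : ∀ x y (i : ℤ), min (1 / ((i : ℝ) ^ 2 + 1)) (dist (e x i) (e y i)) ≤ dist x y)
    {T : X → X} (hT : ∀ x i, e (T x) i = e x (i - 1)) {a b : M} (hab : a ≠ b) :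
    {μ : ↥(invSet T) | D1upper μ.val.toMeasure = (⊤ : EReal)} ∈ residual ↥(invSet T) := by
  subst htop
  have h : (⋂ k, chargedSet e T a b k) ∈ residual ↥(invSet T) :=
    countable_iInter_mem.2 fun k =>
      residual_of_dense_open (isOpen_chargedSet he T a b k) (dense_chargedSet e hT hab k)
  exact mem_of_superset h fun μ hμ => D1upper_eq_top he hdist (Set.mem_iInter.1 hμ)

end Residual

section SeriesMetric

variable {M : Type*} [MetricSpace M]

lemma summable_one_div_int_sq_add_one : Summable fun n : ℤ => 1 / ((n : ℝ) ^ 2 + 1) := by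
  refine Summable.of_norm_bounded_eventually
    (Real.summable_one_div_int_pow.2 (one_lt_two : 1 < 2)) ?_
  filter_upwards [(Set.finite_singleton (0 : ℤ)).compl_mem_cofinite] with n hn
  have hn0 : (n : ℝ) ≠ 0 := by simpa using hn
  rw [Real.norm_of_nonneg (by positivity)]
  gcongr
  linarith

lemma min_dist_le_tsum (x y : ℤ → M) (i : ℤ) :
    min (1 / ((i : ℝ) ^ 2 + 1)) (dist (x i) (y i)) ≤
      ∑' n : ℤ, min (1 / ((n : ℝ) ^ 2 + 1)) (dist (x n) (y n)) :=
  (Summable.of_nonneg_of_le (fun _ => le_min (by positivity) dist_nonneg)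
    (fun _ => min_le_left _ _) summable_one_div_int_sq_add_one).le_tsum i
    fun _ _ => le_min (by positivity) dist_nonneg

lemma pi_topology_eq_of_dist_eq_tsum [mX : MetricSpace (ℤ → M)]
    (hr : ∀ x y : ℤ → M,
      dist x y = ∑' n : ℤ, min (1 / ((n : ℝ) ^ 2 + 1)) (dist (x n) (y n))) :
    (Pi.topologicalSpace : TopologicalSpace (ℤ → M)) =
      mX.toPseudoMetricSpace.toUniformSpace.toTopologicalSpace := by
  apply le_antisymm
  · intro s hs
    refine (@isOpen_iff_mem_nhds (ℤ → M) Pi.topologicalSpace s).2 ?_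
    intro x hx
    obtain ⟨ε, hε, hsub⟩ := Metric.isOpen_iff.1 hs x hx
    have hcont : @Continuous _ _ Pi.topologicalSpace _ fun y : ℤ → M => dist y x := by
      simp_rw [hr]
      refine continuous_tsum (fun n => ?_) summable_one_div_int_sq_add_one fun n y => ?_
      · exact continuous_const.min ((continuous_apply n).dist continuous_const)
      · rw [Real.norm_of_nonneg (le_min (by positivity) dist_nonneg)]
        exact min_le_left _ _
    exact mem_of_superset
      ((hcont.tendsto x).eventually_lt_const (show dist x x < ε by simpa using hε)) hsub
  · rw [Pi.topologicalSpace]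
    refine le_iInf fun i => continuous_iff_le_induced.1 ?_
    rw [Metric.continuous_iff]
    intro x ε hε
    refine ⟨min (1 / ((i : ℝ) ^ 2 + 1)) ε, lt_min (by positivity) hε, fun y hy => ?_⟩
    have h1 := (min_dist_le_tsum y x i).trans_lt ((hr y x).symm.trans_lt hy)
    rcases min_lt_iff.1 h1 with h | h
    · exact absurd (h.trans_le (min_le_left _ _)) (lt_irrefl _)
    · exact h.trans_le (min_le_right _ _)

end SeriesMetric

/-- For the full shift on `X = M^ℤ` (with `M` perfect compact metric, `X`
bearing the metric `r(x,y) = ∑_{n∈ℤ} min (1/(n²+1)) (d(xₙ,yₙ))`), the set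
`ED₊ = {μ ∈ M(T) | D⁺_μ(1) = +∞}` is residual in `M(T)`. -/
theorem statement5 {M : Type*} [MetricSpace M] [CompactSpace M]
    (hperf : Perfect (Set.univ : Set M))
    [mX : MetricSpace (ℤ → M)]
    (hr : ∀ x y : ℤ → M,
      dist x y = ∑' n : ℤ, min (1 / ((n : ℝ) ^ 2 + 1)) (dist (x n) (y n)))
    [MeasurableSpace (ℤ → M)] [BorelSpace (ℤ → M)]
    (T : (ℤ → M) → (ℤ → M)) (hT : ∀ (x : ℤ → M) (i : ℤ), T x i = x (i - 1)) :
    {μ : ↥(invSet T) | D1upper μ.val.toMeasure = (⊤ : EReal)} ∈ residual ↥(invSet T) := by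
  have htop := pi_topology_eq_of_dist_eq_tsum hr
  rcases isEmpty_or_nonempty M with hM | ⟨⟨a⟩⟩
  · have : IsEmpty ↥(invSet T) := ⟨fun μ => by
      have h : μ.val.toMeasure univ = 1 := measure_univ
      simp [Set.eq_empty_of_isEmpty] at h⟩
    simp [Set.eq_univ_of_forall (fun μ => isEmptyElim μ)]
  obtain ⟨b, -, hba⟩ := accPt_iff_nhds.1 (hperf.acc a (mem_univ a)) univ univ_mem
  have hcompact : @CompactSpace (ℤ → M)
      mX.toPseudoMetricSpace.toUniformSpace.toTopologicalSpace :=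
    htop ▸ Function.compactSpace
  have hborel : @BorelSpace (ℤ → M)
      mX.toPseudoMetricSpace.toUniformSpace.toTopologicalSpace _ := htop ▸ ‹BorelSpace (ℤ → M)›
  refine @residual_D1upper_eq_top (ℤ → M) M mX _ hborel _ hcompact Pi.topologicalSpace htop _
    (Equiv.refl _) (fun i => ?_) (fun x y i => ?_) T hT a b hba.symm
  · exact htop ▸ (continuous_apply i : Continuous fun x : ℤ → M => x i)
  · exact (min_dist_le_tsum x y i).trans_eq (hr x y).symm
end

section
/- Let X be a compact metric space, let q > 1 and, for a Borel probability measure μ on X and ε > 0, set J_μ(q,ε) = ∫ f_ε(μ,x)^{q−1} dμ(x). Then D⁺_μ(q) = limsup_{ε→0⁺} log J_μ(q,ε) / ((q−1) log ε) and D⁻_μ(q) = liminf_{ε→0⁺} log J_μ(q,ε) / ((q−1) log ε); moreover, for each fixed ε > 0 the map μ ↦ J_μ(q,ε) is continuous on the space M of Borel probability measures on X with the weak topology. -/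
open MeasureTheory Filter Topology Metric Set
open scoped ENNReal NNReal

section Support

variable {X : Type*} [MetricSpace X] [MeasurableSpace X]

lemma msupp_eq_support (μ : Measure X) : msupp μ = μ.support := by
  ext x
  exact (nhds_basis_ball.mem_measureSupport).symm

lemma msupp_mem_ae [CompactSpace X] (μ : Measure X) : msupp μ ∈ ae μ := by
  rw [msupp_eq_support]
  exact Measure.support_mem_ae

lemma energyI_eq_integral [CompactSpace X] (μ : Measure X) (q ε : ℝ) :
    energyI μ q ε = ∫ x, (μ (ball x ε)).toReal ^ (q - 1) ∂μ := by
  rw [energyI, Measure.restrict_eq_self_of_ae_mem (s := msupp μ) (msupp_mem_ae μ)]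

lemma measurable_measure_ball [CompactSpace X] [BorelSpace X] (μ : Measure X) [SFinite μ]
    (ε : ℝ) : Measurable fun x : X => μ (ball x ε) := by
  have h : MeasurableSet {p : X × X | dist p.2 p.1 < ε} :=
    (isOpen_lt (by fun_prop) (by fun_prop)).measurableSet
  exact measurable_measure_prodMk_left h

lemma integrable_measure_ball_rpow [CompactSpace X] [BorelSpace X] (μ : Measure X)
    [IsProbabilityMeasure μ] {s : ℝ} (hs : 0 ≤ s) (ε : ℝ) :
    Integrable (fun x : X => (μ (ball x ε)).toReal ^ s) μ := by
  refine Integrable.of_bound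
    ((measurable_measure_ball μ ε).ennreal_toReal.pow_const s).aestronglyMeasurable 1
    (.of_forall fun x => ?_)
  rw [Real.norm_of_nonneg (by positivity)]
  exact Real.rpow_le_one (by positivity) measureReal_le_one hs

lemma energyI_pos [CompactSpace X] [BorelSpace X] (μ : Measure X) [IsProbabilityMeasure μ]
    {q : ℝ} (hq : 1 ≤ q) {ε : ℝ} (hε : 0 < ε) : 0 < energyI μ q ε := by
  have hpos : ∀ᵐ x ∂μ, 0 < (μ (ball x ε)).toReal ^ (q - 1) := by
    filter_upwards [msupp_mem_ae μ] with x hx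
    exact Real.rpow_pos_of_pos (ENNReal.toReal_pos (hx ε hε).ne' (measure_ne_top _ _)) _
  rw [energyI_eq_integral, integral_pos_iff_support_of_nonneg (fun x => by positivity)
    (integrable_measure_ball_rpow μ (by linarith) ε)]
  refine pos_iff_ne_zero.2 fun h0 => ?_
  have h : ∀ᵐ _ ∂μ, False := by
    filter_upwards [hpos, measure_eq_zero_iff_ae_notMem.1 h0] with x hx hx'
    exact hx' hx.ne'
  exact IsProbabilityMeasure.ne_zero μ (by simpa using h)

lemma energyI_le_one (μ : Measure X) [IsProbabilityMeasure μ]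
    {q : ℝ} (hq : 1 ≤ q) (ε : ℝ) : energyI μ q ε ≤ 1 := by
  have h : ‖energyI μ q ε‖ ≤ 1 * μ.real (msupp μ) := by
    refine norm_setIntegral_le_of_norm_le_const (measure_lt_top _ _) fun x _ => ?_
    rw [Real.norm_of_nonneg (by positivity)]
    exact Real.rpow_le_one (by positivity) measureReal_le_one (by linarith)
  exact (le_abs_self _).trans (h.trans (by simp))

end Support

section Kernel

variable {X : Type*} [MetricSpace X]

lemma fker_eq_max_min {ε : ℝ} (hε : 0 < ε) (x y : X) :
    fker ε x y = max 0 (min 1 (2 - dist x y / ε)) := by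
  unfold fker
  split_ifs with h1 h2
  · have : dist x y / ε ≤ 1 := (div_le_one hε).2 h1
    rw [min_eq_left (by linarith), max_eq_right zero_le_one]
  · have h3 : 1 ≤ dist x y / ε := (one_le_div hε).2 (not_le.1 h1).le
    have h4 : dist x y / ε ≤ 2 := (div_le_iff₀ hε).2 h2
    rw [min_eq_right (by linarith), max_eq_right (by linarith)]
  · have h4 : 2 ≤ dist x y / ε := (le_div_iff₀ hε).2 (not_le.1 h2).le
    rw [min_eq_right (by linarith), max_eq_left (by linarith)]

lemma continuous_fker {ε : ℝ} (hε : 0 < ε) : Continuous fun p : X × X => fker ε p.1 p.2 := by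
  simp_rw [fker_eq_max_min hε]
  fun_prop

lemma fker_nonneg {ε : ℝ} (hε : 0 < ε) (x y : X) : 0 ≤ fker ε x y := by
  rw [fker_eq_max_min hε]
  exact le_max_left _ _

lemma fker_le_one {ε : ℝ} (hε : 0 < ε) (x y : X) : fker ε x y ≤ 1 := by
  rw [fker_eq_max_min hε]
  exact max_le zero_le_one (min_le_left _ _)

lemma indicator_ball_le_fker {ε : ℝ} (hε : 0 < ε) (x y : X) :
    (ball x ε).indicator (fun _ => (1 : ℝ)) y ≤ fker ε x y := by
  by_cases hy : y ∈ ball x ε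
  · rw [indicator_of_mem hy, fker, if_pos (mem_ball'.1 hy).le]
  · rw [indicator_of_notMem hy]
    exact fker_nonneg hε x y

lemma fker_le_indicator_ball {ε : ℝ} (hε : 0 < ε) (x y : X) :
    fker ε x y ≤ (ball x (2 * ε)).indicator (fun _ => (1 : ℝ)) y := by
  by_cases hy : y ∈ ball x (2 * ε)
  · rw [indicator_of_mem hy]
    exact fker_le_one hε x y
  · rw [indicator_of_notMem hy, fker_eq_max_min hε]
    rw [mem_ball', not_lt] at hy
    have : 2 ≤ dist x y / ε := (le_div_iff₀ hε).2 hy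
    exact max_le le_rfl (min_le_of_right_le (by linarith))

end Kernel

section WeakContinuity

variable {X : Type*} [MetricSpace X] [CompactSpace X] [MeasurableSpace X] [BorelSpace X]

lemma continuous_integral_probabilityMeasure_continuousMap :
    Continuous fun p : ProbabilityMeasure X × C(X, ℝ) => ∫ x, p.2 x ∂(p.1 : Measure X) := by
  rw [continuous_iff_continuousAt]
  rintro ⟨ν₀, g₀⟩
  have hint (ν : ProbabilityMeasure X) (g : C(X, ℝ)) : Integrable g (ν : Measure X) :=
    (BoundedContinuousFunction.mkOfCompact g).integrable _
  have hsplit : (fun p : ProbabilityMeasure X × C(X, ℝ) => ∫ x, p.2 x ∂(p.1 : Measure X)) =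
      fun p => ∫ x, g₀ x ∂(p.1 : Measure X) + ∫ x, (p.2 - g₀) x ∂(p.1 : Measure X) := by
    funext p
    rw [← integral_add (hint _ _) (hint _ _)]
    simp
  have h1 : Tendsto (fun p : ProbabilityMeasure X × C(X, ℝ) => ∫ x, g₀ x ∂(p.1 : Measure X))
      (𝓝 (ν₀, g₀)) (𝓝 (∫ x, g₀ x ∂(ν₀ : Measure X))) :=
    ((ProbabilityMeasure.continuous_integral_boundedContinuousFunction
      (BoundedContinuousFunction.mkOfCompact g₀)).comp continuous_fst).tendsto (ν₀, g₀)
  have h2 : Tendsto (fun p : ProbabilityMeasure X × C(X, ℝ) =>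
      ∫ x, (p.2 - g₀) x ∂(p.1 : Measure X)) (𝓝 (ν₀, g₀)) (𝓝 0) := by
    refine squeeze_zero_norm (a := fun p => ‖p.2 - g₀‖) (fun p => ?_) ?_
    · simpa using norm_integral_le_of_norm_le_const (μ := (p.1 : Measure X))
        (.of_forall fun x => (p.2 - g₀).norm_coe_le_norm x)
    · have : Continuous fun p : ProbabilityMeasure X × C(X, ℝ) => ‖p.2 - g₀‖ := by fun_prop
      simpa using this.tendsto (ν₀, g₀)
  rw [ContinuousAt, hsplit]
  simpa using h1.add h2

lemma continuous_feps_prod {ε : ℝ} (hε : 0 < ε) :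
    Continuous fun p : ProbabilityMeasure X × X => feps ε (p.1 : Measure X) p.2 := by
  let K : C(X, C(X, ℝ)) := ContinuousMap.curry ⟨_, continuous_fker hε⟩
  exact continuous_integral_probabilityMeasure_continuousMap.comp
    (continuous_fst.prodMk (K.continuous.comp continuous_snd))

lemma continuous_feps (μ : Measure X) [IsProbabilityMeasure μ] {ε : ℝ} (hε : 0 < ε) :
    Continuous (feps ε μ) :=
  let ν : ProbabilityMeasure X := ⟨μ, inferInstance⟩
  (continuous_feps_prod hε).comp (Continuous.prodMk_right ν)

lemma continuous_Jfun {q : ℝ} (hq : 1 ≤ q) {ε : ℝ} (hε : 0 < ε) :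
    Continuous fun ν : ProbabilityMeasure X => Jfun (ν : Measure X) q ε := by
  let G : C(ProbabilityMeasure X, C(X, ℝ)) := ContinuousMap.curry
    ⟨_, (continuous_feps_prod hε).rpow_const fun _ => Or.inr (sub_nonneg.2 hq)⟩
  exact continuous_integral_probabilityMeasure_continuousMap.comp
    (continuous_id.prodMk G.continuous)

end WeakContinuity

section Comparison

variable {X : Type*} [MetricSpace X] [CompactSpace X] [MeasurableSpace X] [BorelSpace X]

lemma integrable_fker (μ : Measure X) [IsFiniteMeasure μ] {ε : ℝ} (hε : 0 < ε) (x : X) :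
    Integrable (fker ε x) μ :=
  (BoundedContinuousFunction.mkOfCompact
    ⟨fker ε x, (continuous_fker hε).comp (Continuous.prodMk_right x)⟩).integrable μ

lemma measure_ball_le_feps (μ : Measure X) [IsFiniteMeasure μ] {ε : ℝ} (hε : 0 < ε) (x : X) :
    (μ (ball x ε)).toReal ≤ feps ε μ x := by
  rw [← measureReal_def, ← integral_indicator_one measurableSet_ball]
  exact integral_mono ((integrable_const 1).indicator measurableSet_ball)
    (integrable_fker μ hε x) (indicator_ball_le_fker hε x)

lemma feps_le_measure_ball (μ : Measure X) [IsFiniteMeasure μ] {ε : ℝ} (hε : 0 < ε) (x : X) :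
    feps ε μ x ≤ (μ (ball x (2 * ε))).toReal := by
  rw [← measureReal_def, ← integral_indicator_one measurableSet_ball]
  exact integral_mono (integrable_fker μ hε x)
    ((integrable_const 1).indicator measurableSet_ball) (fker_le_indicator_ball hε x)

lemma integrable_feps_rpow (μ : Measure X) [IsProbabilityMeasure μ] {s : ℝ} (hs : 0 ≤ s)
    {ε : ℝ} (hε : 0 < ε) : Integrable (fun x => feps ε μ x ^ s) μ :=
  (BoundedContinuousFunction.mkOfCompact
    ⟨_, (continuous_feps μ hε).rpow_const fun _ => Or.inr hs⟩).integrable μ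

lemma energyI_le_Jfun (μ : Measure X) [IsProbabilityMeasure μ] {q : ℝ} (hq : 1 ≤ q)
    {ε : ℝ} (hε : 0 < ε) : energyI μ q ε ≤ Jfun μ q ε := by
  have hs : 0 ≤ q - 1 := sub_nonneg.2 hq
  rw [energyI_eq_integral]
  exact integral_mono (integrable_measure_ball_rpow μ hs ε) (integrable_feps_rpow μ hs hε)
    fun x => Real.rpow_le_rpow (by positivity) (measure_ball_le_feps μ hε x) hs

lemma Jfun_le_energyI (μ : Measure X) [IsProbabilityMeasure μ] {q : ℝ} (hq : 1 ≤ q)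
    {ε : ℝ} (hε : 0 < ε) : Jfun μ q ε ≤ energyI μ q (2 * ε) := by
  have hs : 0 ≤ q - 1 := sub_nonneg.2 hq
  rw [energyI_eq_integral]
  exact integral_mono (integrable_feps_rpow μ hs hε) (integrable_measure_ball_rpow μ hs _)
    fun x => Real.rpow_le_rpow (integral_nonneg (fker_nonneg hε x))
      (feps_le_measure_ball μ hε x) hs

end Comparison

section LogScale

lemma map_mul_left_nhdsGT_zero {c : ℝ} (hc : 0 < c) :
    map (fun ε : ℝ => c * ε) (𝓝[>] 0) = 𝓝[>] 0 := by
  have h := (Homeomorph.mulLeft₀ c hc.ne').isEmbedding.map_nhdsWithin_eq (Ioi 0) 0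
  simpa [image_mul_left_Ioi hc] using h

lemma tendsto_log_two_mul_div_log :
    Tendsto (fun ε : ℝ => Real.log (2 * ε) / Real.log ε) (𝓝[>] 0) (𝓝 1) := by
  have h : Tendsto (fun ε : ℝ => Real.log 2 / Real.log ε + 1) (𝓝[>] 0) (𝓝 (0 + 1)) :=
    (Real.tendsto_log_nhdsGT_zero.const_div_atBot _).add_const 1
  rw [zero_add] at h
  refine h.congr' ?_
  filter_upwards [Ioo_mem_nhdsGT (zero_lt_one' ℝ)] with ε hε
  have := (Real.log_neg hε.1 hε.2).ne
  rw [Real.log_mul two_ne_zero hε.1.ne']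
  field_simp

variable {a b c : ℝ → ℝ}

/-- If `a (2 ε) * c ε ≤ b ε ≤ a ε` near `0⁺`, where `a ≥ 0` and `c` tends to `1`, then `a` and `b`
have the same upper limit at `0⁺`. -/
lemma limsup_eq_of_doubling (ha : ∀ᶠ ε in 𝓝[>] (0 : ℝ), 0 ≤ a ε)
    (hc : Tendsto c (𝓝[>] 0) (𝓝 1)) (hba : ∀ᶠ ε in 𝓝[>] (0 : ℝ), b ε ≤ a ε)
    (hab : ∀ᶠ ε in 𝓝[>] (0 : ℝ), a (2 * ε) * c ε ≤ b ε) :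
    limsup (fun ε => (a ε : EReal)) (𝓝[>] 0) = limsup (fun ε => (b ε : EReal)) (𝓝[>] 0) := by
  have hmap := map_mul_left_nhdsGT_zero (zero_lt_two' ℝ)
  have hc' : Tendsto (fun ε => (c ε : EReal)) (𝓝[>] 0) (𝓝 1) :=
    (continuous_coe_real_ereal.tendsto 1).comp hc
  have hc0 : 0 ≤ᶠ[𝓝[>] (0 : ℝ)] fun ε => (c ε : EReal) := by
    filter_upwards [hc.eventually_const_lt zero_lt_one] with ε h
    exact EReal.coe_nonneg.2 h.le
  have ha0 : 0 ≤ᶠ[𝓝[>] (0 : ℝ)] fun ε => (a (2 * ε) : EReal) := by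
    filter_upwards [eventually_map.1 (hmap.symm ▸ ha)] with ε h
    exact EReal.coe_nonneg.2 h
  refine le_antisymm ?_ ?_
  · calc limsup (fun ε => (a ε : EReal)) (𝓝[>] 0)
        = limsup (fun ε => (a ε : EReal)) (map (fun ε : ℝ => 2 * ε) (𝓝[>] 0)) := by rw [hmap]
      _ = limsup (fun ε => (a (2 * ε) : EReal)) (𝓝[>] 0) *
            liminf (fun ε => (c ε : EReal)) (𝓝[>] 0) := by
          rw [hc'.liminf_eq, mul_one]; rfl
      _ ≤ limsup ((fun ε => (a (2 * ε) : EReal)) * fun ε => (c ε : EReal)) (𝓝[>] 0) :=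
          EReal.le_limsup_mul ha0.frequently hc0
      _ ≤ limsup (fun ε => (b ε : EReal)) (𝓝[>] 0) := by
          refine limsup_le_limsup ?_
          filter_upwards [hab] with ε h
          rw [Pi.mul_apply]
          exact_mod_cast h
  · refine limsup_le_limsup ?_
    filter_upwards [hba] with ε h
    exact_mod_cast h

/-- If `a (2 ε) * c ε ≤ b ε ≤ a ε` near `0⁺`, where `a ≥ 0` and `c` tends to `1`, then `a` and `b`
have the same lower limit at `0⁺`. -/
lemma liminf_eq_of_doubling (ha : ∀ᶠ ε in 𝓝[>] (0 : ℝ), 0 ≤ a ε)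
    (hc : Tendsto c (𝓝[>] 0) (𝓝 1)) (hba : ∀ᶠ ε in 𝓝[>] (0 : ℝ), b ε ≤ a ε)
    (hab : ∀ᶠ ε in 𝓝[>] (0 : ℝ), a (2 * ε) * c ε ≤ b ε) :
    liminf (fun ε => (a ε : EReal)) (𝓝[>] 0) = liminf (fun ε => (b ε : EReal)) (𝓝[>] 0) := by
  have hmap := map_mul_left_nhdsGT_zero (zero_lt_two' ℝ)
  have hc' : Tendsto (fun ε => (c ε : EReal)) (𝓝[>] 0) (𝓝 1) :=
    (continuous_coe_real_ereal.tendsto 1).comp hc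
  have hc0 : 0 ≤ᶠ[𝓝[>] (0 : ℝ)] fun ε => (c ε : EReal) := by
    filter_upwards [hc.eventually_const_lt zero_lt_one] with ε h
    exact EReal.coe_nonneg.2 h.le
  have ha0 : 0 ≤ᶠ[𝓝[>] (0 : ℝ)] fun ε => (a (2 * ε) : EReal) := by
    filter_upwards [eventually_map.1 (hmap.symm ▸ ha)] with ε h
    exact EReal.coe_nonneg.2 h
  refine le_antisymm ?_ ?_
  · calc liminf (fun ε => (a ε : EReal)) (𝓝[>] 0)
        = liminf (fun ε => (a ε : EReal)) (map (fun ε : ℝ => 2 * ε) (𝓝[>] 0)) := by rw [hmap]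
      _ = liminf (fun ε => (a (2 * ε) : EReal)) (𝓝[>] 0) *
            liminf (fun ε => (c ε : EReal)) (𝓝[>] 0) := by
          rw [hc'.liminf_eq, mul_one]; rfl
      _ ≤ liminf ((fun ε => (a (2 * ε) : EReal)) * fun ε => (c ε : EReal)) (𝓝[>] 0) :=
          EReal.le_liminf_mul ha0 hc0
      _ ≤ liminf (fun ε => (b ε : EReal)) (𝓝[>] 0) := by
          refine liminf_le_liminf ?_
          filter_upwards [hab] with ε h
          rw [Pi.mul_apply]
          exact_mod_cast h
  · refine liminf_le_liminf ?_
    filter_upwards [hba] with ε h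
    exact_mod_cast h

end LogScale

/-- For a compact metric space `X` and `q > 1`, with
`J_μ(q,ε) = ∫ f_ε(μ,x)^(q-1) dμ(x)`: `D⁺_μ(q)` and `D⁻_μ(q)` coincide with the
limsup/liminf as `ε → 0⁺` of `log J_μ(q,ε)/((q-1) log ε)`, and for each fixed `ε > 0` the map
`μ ↦ J_μ(q,ε)` is continuous in the weak topology. -/
theorem statement13 {X : Type*} [MetricSpace X] [CompactSpace X]
    [MeasurableSpace X] [BorelSpace X]
    (q : ℝ) (hq : 1 < q) (μ : Measure X) [IsProbabilityMeasure μ] :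
    Dupper μ q = limsup (fun ε : ℝ =>
        ((Real.log (Jfun μ q ε) / ((q - 1) * Real.log ε) : ℝ) : EReal)) (𝓝[>] (0 : ℝ)) ∧
    Dlower μ q = liminf (fun ε : ℝ =>
        ((Real.log (Jfun μ q ε) / ((q - 1) * Real.log ε) : ℝ) : EReal)) (𝓝[>] (0 : ℝ)) ∧
    (∀ ε : ℝ, 0 < ε →
      Continuous (fun ν : ProbabilityMeasure X => Jfun ν.toMeasure q ε)) := by
  have hq0 : 0 < q - 1 := sub_pos.2 hq
  have ha : ∀ᶠ ε in 𝓝[>] (0 : ℝ),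
      0 ≤ Real.log (energyI μ q ε) / ((q - 1) * Real.log ε) := by
    filter_upwards [Ioo_mem_nhdsGT (zero_lt_one' ℝ)] with ε hε
    exact div_nonneg_of_nonpos
      (Real.log_nonpos (energyI_pos μ hq.le hε.1).le (energyI_le_one μ hq.le ε))
      (mul_nonpos_of_nonneg_of_nonpos hq0.le (Real.log_neg hε.1 hε.2).le)
  have hba : ∀ᶠ ε in 𝓝[>] (0 : ℝ), Real.log (Jfun μ q ε) / ((q - 1) * Real.log ε) ≤
      Real.log (energyI μ q ε) / ((q - 1) * Real.log ε) := by
    filter_upwards [Ioo_mem_nhdsGT (zero_lt_one' ℝ)] with ε hε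
    exact div_le_div_of_nonpos_of_le
      (mul_nonpos_of_nonneg_of_nonpos hq0.le (Real.log_neg hε.1 hε.2).le)
      (Real.log_le_log (energyI_pos μ hq.le hε.1) (energyI_le_Jfun μ hq.le hε.1))
  have hab : ∀ᶠ ε in 𝓝[>] (0 : ℝ),
      Real.log (energyI μ q (2 * ε)) / ((q - 1) * Real.log (2 * ε)) *
        (Real.log (2 * ε) / Real.log ε) ≤ Real.log (Jfun μ q ε) / ((q - 1) * Real.log ε) := by
    filter_upwards [Ioo_mem_nhdsGT (one_half_pos (α := ℝ))] with ε hε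
    have hlog : Real.log ε < 0 := Real.log_neg hε.1 (by linarith [hε.2])
    have hlog2 : Real.log (2 * ε) < 0 := Real.log_neg (by linarith [hε.1]) (by linarith [hε.2])
    have hJ : 0 < Jfun μ q ε :=
      (energyI_pos μ hq.le hε.1).trans_le (energyI_le_Jfun μ hq.le hε.1)
    rw [div_mul_div_comm, mul_right_comm, mul_div_mul_right _ _ hlog2.ne]
    exact div_le_div_of_nonpos_of_le (mul_nonpos_of_nonneg_of_nonpos hq0.le hlog.le)
      (Real.log_le_log hJ (Jfun_le_energyI μ hq.le hε.1))
  exact ⟨limsup_eq_of_doubling ha tendsto_log_two_mul_div_log hba hab,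
    liminf_eq_of_doubling ha tendsto_log_two_mul_div_log hba hab,
    fun _ hε => continuous_Jfun hq.le hε⟩
end
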